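/- arXiv:2510.08310 — 2 statements merged into one kernel-verified Lean document; each statement's English description precedes it below -/
import Mathlib

section
/- Let G be obtained from the prism C_n □ K_2 with n odd by applying TF-inflations at vertices lying on at least three distinct pillars. Then G is non-hamiltonian but possesses a hamiltonian path. -/
open SimpleGraph

/-- Vertex type of the `n`-prism `C_n □ K_2`: the base cycle consists of the
vertices `(i, false)` (the `sᵢ`) and the top cycle of the vertices `(i, true)` (the `tᵢ`). -/
abbrev PV (n : ℕ) := ZMod n × Bool

/-- The prism graph `C_n □ K_2`. -/
def prismG (n : ℕ) : SimpleGraph (PV n) :=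
  SimpleGraph.fromRel fun u v =>
    (u.1 = v.1 ∧ u.2 ≠ v.2) ∨ (u.2 = v.2 ∧ v.1 = u.1 + 1)

/-- The pillar edge `sᵢtᵢ`. -/
def pillar (n : ℕ) (i : ZMod n) : Sym2 (PV n) :=
  s(((i, false) : PV n), ((i, true) : PV n))

/-- The base-cycle edge `sᵢs_{i+1}`. -/
def baseEdge (n : ℕ) (i : ZMod n) : Sym2 (PV n) :=
  s(((i, false) : PV n), ((i + 1, false) : PV n))

/-- The top-cycle edge `tᵢt_{i+1}`. -/
def topEdge (n : ℕ) (i : ZMod n) : Sym2 (PV n) :=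
  s(((i, true) : PV n), ((i + 1, true) : PV n))

def IsPillar {n : ℕ} (e : Sym2 (PV n)) : Prop := ∃ i, e = pillar n i
def IsBaseEdge {n : ℕ} (e : Sym2 (PV n)) : Prop := ∃ i, e = baseEdge n i
def IsTopEdge {n : ℕ} (e : Sym2 (PV n)) : Prop := ∃ i, e = topEdge n i

/-- A hamiltonian cycle of the prism is *meandering* if no two of its edges lying on the
top cycle or on the base cycle are adjacent (share a vertex; in a cycle, edges sharing a
vertex are exactly the consecutive ones). -/
def Meandering {n : ℕ} {v : PV n} (C : (prismG n).Walk v v) : Prop :=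
  ∀ e ∈ C.edges, ∀ f ∈ C.edges, e ≠ f →
    ((IsBaseEdge e ∧ IsBaseEdge f) ∨ (IsTopEdge e ∧ IsTopEdge f)) → ¬ ∃ x, x ∈ e ∧ x ∈ f

/-- Explicit edge list of the Tutte Fragment on 15 vertices, following Tutte (1946):
`0 = a`, `1 = b` (the two bottom corner 2-valent vertices), `2 = c` (the apex 2-valent
vertex); `3, …, 14` are the internal 3-valent vertices `p₁, …, p₁₂`. -/
def TFedges : List (Fin 15 × Fin 15) :=
  [(0,4),(4,5),(5,6),(6,2),(1,7),(7,8),(8,2),(0,14),(14,1),(4,9),(9,3),(3,10),(10,7),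
   (5,11),(11,12),(6,13),(13,8),(13,12),(12,10),(11,9),(3,14)]

/-- The Tutte Fragment as a simple graph on `Fin 15`. -/
def TF : SimpleGraph (Fin 15) :=
  SimpleGraph.fromRel fun x y => (x, y) ∈ TFedges

/-- The attachment port of the prism vertex `u` used for the former prism edge towards the
neighbour `w`, after the TF-inflations prescribed by the set `S` of inflated vertices and the
orientation choice `orient`.  A non-inflated vertex keeps its single representative (port `0`);
for an inflated vertex the vertex `c = 2` of its Tutte Fragment is incident with the pillar,
and the vertices `a = 0`, `b = 1` are attached to the two cycle neighbours according to
`orient u`. -/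
def port {n : ℕ} (S : Finset (PV n)) (orient : PV n → Bool) (u w : PV n) : Fin 15 :=
  if u ∉ S then 0
  else if u.1 = w.1 then 2
  else if w.1 = u.1 + 1 then (if orient u then 0 else 1)
  else (if orient u then 1 else 0)

/-- Vertex type of the TF-inflated prism: an inflated prism vertex `v ∈ S` is replaced by the
15 vertices `(v, k)` of a fresh copy of the Tutte Fragment, while a non-inflated vertex `v`
is represented by `(v, 0)` alone. -/
def InflV (n : ℕ) (S : Finset (PV n)) := {x : PV n × Fin 15 // x.1 ∈ S ∨ x.2 = 0}

/-- The graph obtained from the prism `C_n □ K_2` by TF-inflating every vertex in `S`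
(with orientations `orient`, and with the `c`-vertex of each fragment incident to the
corresponding pillar). -/
def inflPrism (n : ℕ) (S : Finset (PV n)) (orient : PV n → Bool) :
    SimpleGraph (InflV n S) :=
  SimpleGraph.fromRel fun x y =>
    (x.val.1 = y.val.1 ∧ x.val.1 ∈ S ∧ TF.Adj x.val.2 y.val.2) ∨
    (x.val.1 ≠ y.val.1 ∧ (prismG n).Adj x.val.1 y.val.1 ∧
      x.val.2 = port S orient x.val.1 y.val.1 ∧
      y.val.2 = port S orient y.val.1 x.val.1)

/-- The vertex of the inflated prism representing the attachment port of the prism vertex `u`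
towards its prism neighbour `w`. -/
def liftV {n : ℕ} (S : Finset (PV n)) (orient : PV n → Bool) (u w : PV n) :
    InflV n S :=
  ⟨(u, port S orient u w), by
    by_cases h : u ∈ S
    · exact Or.inl h
    · exact Or.inr (by simp [port, h])⟩

/-- The set of (indices of) pillars of the prism carrying at least one TF-inflated vertex. -/
def inflatedPillars {n : ℕ} (S : Finset (PV n)) : Set (ZMod n) :=
  {i : ZMod n | ((i, false) : PV n) ∈ S ∨ ((i, true) : PV n) ∈ S}

instance (n : ℕ) (S : Finset (PV n)) : DecidableEq (InflV n S) := by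
  unfold InflV; infer_instance


open Classical in
/-- Indicator of a proposition. -/
noncomputable def ind (p : Prop) : ℕ := if p then 1 else 0

lemma ind_le (p : Prop) : ind p ≤ 1 := by unfold ind; split_ifs <;> simp
lemma ind_pos {p : Prop} (h : p) : ind p = 1 := by simp [ind, h]
lemma ind_one {p : Prop} : ind p = 1 ↔ p := by simp [ind]
lemma ind_zero {p : Prop} : ind p = 0 ↔ ¬ p := by simp [ind]

lemma deg_lemma {V : Type*} (E : V → Prop) (a b c : V) (hab : a ≠ b) (hac : a ≠ c)
    (hbc : b ≠ c) (h2 : {y | E y}.ncard = 2) (hsub : ∀ y, E y → y = a ∨ y = b ∨ y = c) :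
    ind (E a) + ind (E b) + ind (E c) = 2 := by
  classical
  have : {y | E y} = (({a, b, c} : Finset V).filter E : Finset V) := by
    ext y
    simp only [Set.mem_ofPred_eq, Finset.coe_filter, Finset.mem_insert, Finset.mem_singleton]
    exact ⟨fun h => ⟨hsub y h, h⟩, fun h => h.2⟩
  rw [this, Set.ncard_coe_finset, Finset.card_filter] at h2
  rw [Finset.sum_insert (by simp [hab, hac]), Finset.sum_insert (by simp [hbc]),
    Finset.sum_singleton] at h2
  simp only [ind]
  convert h2 using 1
  ring

lemma ham_facts {V : Type*} [DecidableEq V] {G : SimpleGraph V} {x : V} (C : G.Walk x x)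
    (hC : C.IsHamiltonianCycle) : ∃ E : V → V → Prop, (∀ u v, E u v → E v u) ∧
      (∀ u v, E u v → G.Adj u v) ∧ (∀ u, {v | E u v}.ncard = 2) ∧
      (∀ W : Set V, ∀ a b, a ∈ W → b ∉ W → ∃ u v, u ∈ W ∧ v ∉ W ∧ E u v) := by
  refine ⟨fun u v => C.toSubgraph.Adj u v, fun u v h => h.symm, fun u v h => h.adj_sub, ?_, ?_⟩
  · intro u
    exact hC.isCycle.ncard_neighborSet_toSubgraph_eq_two (hC.mem_support u)
  · intro W a b ha hb
    have hc := C.toSubgraph_connected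
    have ha' : a ∈ C.toSubgraph.verts := by simpa using hC.mem_support a
    have hb' : b ∈ C.toSubgraph.verts := by simpa using hC.mem_support b
    obtain ⟨p⟩ := hc.preconnected ⟨a, ha'⟩ ⟨b, hb'⟩
    obtain ⟨d, -, h1, h2⟩ := p.exists_boundary_dart {z | (z : V) ∈ W} ha hb
    exact ⟨d.fst, d.snd, h1, h2, d.adj⟩

lemma tf_arith (x0 x1 x2 x3 x4 x5 x6 x7 x8 x9 x10 x11 x12 x13 x14 x15 x16 x17 x18 x19 x20
    pa pb pc : ℕ)
    (b0 : x0 ≤ 1) (b1 : x1 ≤ 1) (b2 : x2 ≤ 1) (b3 : x3 ≤ 1) (b4 : x4 ≤ 1) (b5 : x5 ≤ 1)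
    (b6 : x6 ≤ 1) (b7 : x7 ≤ 1) (b8 : x8 ≤ 1) (b9 : x9 ≤ 1) (b10 : x10 ≤ 1) (b11 : x11 ≤ 1)
    (b12 : x12 ≤ 1) (b13 : x13 ≤ 1) (b14 : x14 ≤ 1) (b15 : x15 ≤ 1) (b16 : x16 ≤ 1)
    (b17 : x17 ≤ 1) (b18 : x18 ≤ 1) (b19 : x19 ≤ 1) (b20 : x20 ≤ 1)
    (ba : pa ≤ 1) (bb : pb ≤ 1) (bc : pc ≤ 1)
    (h0 : x0 + x7 + pa = 2) (h1 : x4 + x8 + pb = 2) (h2 : x3 + x6 + pc = 2)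
    (h3 : x10 + x11 + x20 = 2) (h4 : x0 + x1 + x9 = 2) (h5 : x1 + x2 + x13 = 2)
    (h6 : x2 + x3 + x15 = 2) (h7 : x4 + x5 + x12 = 2) (h8 : x5 + x6 + x16 = 2)
    (h9 : x9 + x10 + x19 = 2) (h10 : x11 + x12 + x18 = 2) (h11 : x13 + x14 + x19 = 2)
    (h12 : x14 + x17 + x18 = 2) (h13 : x15 + x16 + x17 = 2) (h14 : x7 + x8 + x20 = 2)
    (c0 : pa + pb + pc ≠ 0) :
    (pc = 1 ∧ pa + pb = 1) ∨ (pa = 1 ∧ pb = 1 ∧ pc = 0 ∧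
      ((x0 = 0 ∧ x4 = 0 ∧ x20 = 0) ∨ (x2 = 0 ∧ x5 = 0 ∧ x17 = 0) ∨
       (x0 = 0 ∧ x5 = 0 ∧ x10 = 0 ∧ x18 = 0) ∨ (x0 = 0 ∧ x2 = 0 ∧ x10 = 0 ∧ x14 = 0) ∨
       (x2 = 0 ∧ x4 = 0 ∧ x11 = 0 ∧ x14 = 0))) := by
  by_cases hpc : pc = 1
  · left; omega
  · right
    have e1 : pa = 1 := by omega
    have e2 : pb = 1 := by omega
    have e3 : pc = 0 := by omega
    refine ⟨e1, e2, e3, ?_⟩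
    have e4 : x3 = 1 := by omega
    have e5 : x6 = 1 := by omega
    subst e1 e2 e3 e4 e5
    have k0 : x0 = 0 ∨ x0 = 1 := by omega
    have k4 : x4 = 0 ∨ x4 = 1 := by omega
    have k2 : x2 = 0 ∨ x2 = 1 := by omega
    have k5 : x5 = 0 ∨ x5 = 1 := by omega
    have k10 : x10 = 0 ∨ x10 = 1 := by omega
    have k14 : x14 = 0 ∨ x14 = 1 := by omega
    rcases k0 with rfl | rfl <;> rcases k4 with rfl | rfl <;> rcases k2 with rfl | rfl <;>
      rcases k5 with rfl | rfl <;> rcases k10 with rfl | rfl <;> rcases k14 with rfl | rfl <;>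
      omega

instance : DecidableRel TF.Adj := by
  unfold TF; intro a b; simp only [SimpleGraph.fromRel_adj]; infer_instance

lemma tf_key (F : Fin 15 → Fin 15 → Prop) (hs : ∀ i j, F i j → F j i)
    (hF : ∀ i j, F i j → TF.Adj i j) (pa pb pc : ℕ)
    (ba : pa ≤ 1) (bb : pb ≤ 1) (bc : pc ≤ 1)
    (hd : ∀ k i j l, i ≠ j → i ≠ l → j ≠ l → 3 ≤ k → (∀ m, TF.Adj k m → m = i ∨ m = j ∨ m = l) →
      ind (F k i) + ind (F k j) + ind (F k l) = 2)
    (h0 : ind (F 0 4) + ind (F 0 14) + pa = 2)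
    (h1 : ind (F 1 7) + ind (F 1 14) + pb = 2)
    (h2 : ind (F 2 6) + ind (F 2 8) + pc = 2)
    (hcut : ∀ W : Finset (Fin 15), W.Nonempty → (0 ∈ W → pa = 0) → (1 ∈ W → pb = 0) →
      (2 ∈ W → pc = 0) → ∃ i j, i ∈ W ∧ j ∉ W ∧ F i j) :
    pc = 1 ∧ pa + pb = 1 := by
  have sy : ∀ i j, ind (F i j) = ind (F j i) := by
    intro i j
    congr 1
    exact propext ⟨hs i j, hs j i⟩
  have g3 := hd 3 9 10 14 (by decide) (by decide) (by decide) (by decide) (by decide)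
  have g4 := hd 4 0 5 9 (by decide) (by decide) (by decide) (by decide) (by decide)
  have g5 := hd 5 4 6 11 (by decide) (by decide) (by decide) (by decide) (by decide)
  have g6 := hd 6 5 2 13 (by decide) (by decide) (by decide) (by decide) (by decide)
  have g7 := hd 7 1 8 10 (by decide) (by decide) (by decide) (by decide) (by decide)
  have g8 := hd 8 7 2 13 (by decide) (by decide) (by decide) (by decide) (by decide)
  have g9 := hd 9 4 3 11 (by decide) (by decide) (by decide) (by decide) (by decide)
  have g10 := hd 10 3 7 12 (by decide) (by decide) (by decide) (by decide) (by decide)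
  have g11 := hd 11 5 12 9 (by decide) (by decide) (by decide) (by decide) (by decide)
  have g12 := hd 12 11 13 10 (by decide) (by decide) (by decide) (by decide) (by decide)
  have g13 := hd 13 6 8 12 (by decide) (by decide) (by decide) (by decide) (by decide)
  have g14 := hd 14 0 1 3 (by decide) (by decide) (by decide) (by decide) (by decide)
  rw [sy 2 6, sy 2 8] at h2
  rw [sy 1 14] at h1
  rw [sy 14 1] at g14 h1
  rw [sy 14 0, sy 14 3] at g14
  rw [sy 3 9] at g3
  rw [sy 4 0] at g4
  rw [sy 5 4] at g5
  rw [sy 6 5] at g6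
  rw [sy 7 1, sy 7 10] at g7
  rw [sy 8 7, sy 8 13] at g8
  rw [sy 9 4, sy 9 11] at g9
  rw [sy 10 3, sy 10 12] at g10
  rw [sy 11 5] at g11
  rw [sy 12 11, sy 12 13] at g12
  rw [sy 13 6] at g13
  have key := tf_arith (ind (F 0 4)) (ind (F 4 5)) (ind (F 5 6)) (ind (F 6 2)) (ind (F 1 7))
    (ind (F 7 8)) (ind (F 8 2)) (ind (F 0 14)) (ind (F 1 14)) (ind (F 4 9)) (ind (F 9 3))
    (ind (F 3 10)) (ind (F 10 7)) (ind (F 5 11)) (ind (F 11 12)) (ind (F 6 13)) (ind (F 13 8))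
    (ind (F 13 12)) (ind (F 12 10)) (ind (F 11 9)) (ind (F 3 14)) pa pb pc
    (ind_le _) (ind_le _) (ind_le _) (ind_le _) (ind_le _) (ind_le _) (ind_le _)
    (ind_le _) (ind_le _) (ind_le _) (ind_le _) (ind_le _) (ind_le _) (ind_le _)
    (ind_le _) (ind_le _) (ind_le _) (ind_le _) (ind_le _) (ind_le _) (ind_le _) ba bb bc
    h0 h1 h2 g3 g4 g5 g6 g7 g8 g9 g10 g11 g12 g13
    g14
    (by
      intro h
      obtain ⟨i, j, -, hj, -⟩ := hcut Finset.univ Finset.univ_nonempty (by omega) (by omega)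
        (by omega)
      exact hj (Finset.mem_univ _))
  have fin : ∀ W : Finset (Fin 15), W.Nonempty → 0 ∉ W → 1 ∉ W → pc = 0 →
      ∀ L : List (Fin 15 × Fin 15), (∀ i j, i ∈ W → j ∉ W → TF.Adj i j → (i, j) ∈ L ∨ (j, i) ∈ L) →
      ∃ e ∈ L, ind (F e.1 e.2) = 1 := by
    intro W hW w0 w1 hp L hL
    obtain ⟨i, j, hi, hj, hij⟩ := hcut W hW (fun h => absurd h w0) (fun h => absurd h w1)
      (fun _ => hp)
    rcases hL i j hi hj (hF i j hij) with h | h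
    · exact ⟨_, h, ind_pos hij⟩
    · exact ⟨_, h, ind_pos (hs _ _ hij)⟩
  rcases key with h | ⟨-, -, hp, h⟩
  · exact h
  exfalso
  rcases h with h | h | h | h | h
  · have := fin {2, 3, 4, 5, 6, 7, 8, 9, 10, 11, 12, 13} (by decide) (by decide) (by decide) hp
      [(0, 4), (1, 7), (3, 14)] (by decide)
    simp at this; omega
  · have := fin {2, 6, 8, 13} (by decide) (by decide) (by decide) hp
      [(5, 6), (7, 8), (13, 12)] (by decide)
    simp at this; omega
  · have := fin {2, 4, 5, 6, 8, 9, 11, 12, 13} (by decide) (by decide) (by decide) hp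
      [(0, 4), (7, 8), (9, 3), (12, 10)] (by decide)
    simp at this; omega
  · have := fin {4, 5, 9, 11} (by decide) (by decide) (by decide) hp
      [(0, 4), (5, 6), (9, 3), (11, 12)] (by decide)
    simp at this; omega
  · have := fin {2, 6, 7, 8, 10, 12, 13} (by decide) (by decide) (by decide) hp
      [(5, 6), (1, 7), (3, 10), (11, 12)] (by decide)
    simp at this; omega

lemma zmod_ind (n : ℕ) [NeZero n] (p : ZMod n → Prop) (i : ZMod n) (h0 : p i)
    (hs : ∀ k, p k → p (k + 1)) : ∀ k, p k := by
  have : ∀ m : ℕ, p (i + m) := by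
    intro m
    induction m with
    | zero => simpa using h0
    | succ m ih => have := hs _ ih; push_cast; rwa [← add_assoc]
  intro k
  have := this (k - i).val
  simpa using this

lemma prism_final (n : ℕ) (hn : 3 ≤ n) (hodd : Odd n) (B T P : ZMod n → ℕ)
    (bB : ∀ i, B i ≤ 1) (bT : ∀ i, T i ≤ 1) (bP : ∀ i, P i ≤ 1)
    (hB : ∀ i, B (i + 1) + B i + P (i + 1) = 2) (hT : ∀ i, T (i + 1) + T i + P (i + 1) = 2)
    (hcut : ∀ A : Set (ZMod n), ∀ a b, a ∈ A → b ∉ A →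
      ∃ k, ((k ∈ A ∧ k + 1 ∉ A) ∨ (k ∉ A ∧ k + 1 ∈ A)) ∧ (B k = 1 ∨ T k = 1)) :
    {i | P i = 1}.ncard ≤ 2 := by
  have : NeZero n := ⟨by omega⟩
  have : Fact (1 < n) := ⟨by omega⟩
  have hneg : (-1 : ZMod n).val = n - 1 := by
    obtain ⟨m, rfl⟩ : ∃ m, n = m + 1 := ⟨n - 1, by omega⟩
    exact ZMod.val_neg_one m
  by_cases hall : ∀ i, P i = 1
  · exfalso
    have alt : ∀ m : ℕ, B (m : ZMod n) + (if Even m then 0 else 1) = B 0 ∨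
        B (m : ZMod n) = B 0 + (if Even m then 0 else 1) := by
      intro m
      induction m with
      | zero => simp
      | succ m ih =>
        have h1 := hB m
        have h2 := hall (m + 1)
        have h3 := bB m
        have h4 := bB 0
        have h5 := bB (m+1)
        push_cast
        by_cases he : Even m
        · have he' : ¬ Even (m + 1) := by rw [Nat.even_add_one]; simpa using he
          rw [if_pos he] at ih
          rw [if_neg he']
          omega
        · have he' : Even (m + 1) := by rw [Nat.even_add_one]; exact he
          rw [if_neg he] at ih
          rw [if_pos he']
          omega
    have := alt n
    simp only [ZMod.natCast_self] at this
    rw [if_neg (by simpa using hodd)] at this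
    omega
  push Not at hall
  obtain ⟨i0, hi0⟩ := hall
  have heq : ∀ k, B k = T k := by
    apply zmod_ind n (fun k => B k = T k) i0
    · have h1 := hB (i0 - 1)
      have h2 := hT (i0 - 1)
      rw [sub_add_cancel] at h1 h2
      have := bB i0; have := bT i0; have := bB (i0-1); have := bT (i0-1); have := bP i0
      omega
    · intro k hk
      have h1 := hB k
      have h2 := hT k
      omega
  have huniq : ∀ i j, B i = 0 → B j = 0 → i = j := by
    intro i j hi hj
    by_contra hne
    set m := j - (i + 1) with hm
    obtain ⟨k, hk, hk1⟩ := hcut {k | (k - (i + 1)).val ≤ m.val} (i + 1) i (by simp) (by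
      simp only [Set.mem_ofPred_eq, not_le]
      have : i - (i + 1) = -1 := by ring
      rw [this]
      rw [hneg]
      have h1 := ZMod.val_lt m
      have h2 : m.val ≠ n - 1 := by
        intro h
        rw [← hneg] at h
        have := ZMod.val_injective n h
        apply hne
        have : j = i + 1 + m := by rw [hm]; ring
        rw [this, ‹m = -1›]; ring
      omega)
    have hBk : B k = 1 := by have := heq k; omega
    simp only [Set.mem_ofPred_eq] at hk
    have e : k + 1 - (i + 1) = (k - (i + 1)) + 1 := by ring
    rw [e] at hk
    by_cases hx : k - (i + 1) = -1
    · have : k = i := by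
        have := congrArg (· + (i + 1)) hx
        simpa using this
      rw [this] at hBk; omega
    · have hv : (k - (i + 1) + 1).val = (k - (i + 1)).val + 1 := by
        have h0 := ZMod.val_add_of_lt (a := k - (i + 1)) (b := (1 : ZMod n))
        rw [ZMod.val_one] at h0
        apply h0
        have h1 := ZMod.val_lt (k - (i + 1))
        have h2 : (k - (i + 1)).val ≠ n - 1 := by
          intro h
          rw [← hneg] at h
          exact hx (ZMod.val_injective n h)
        omega
      rw [hv] at hk
      have : (k - (i + 1)).val = m.val := by omega
      have := ZMod.val_injective n this
      have : k = j := by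
        rw [hm] at this
        exact sub_left_injective this
      rw [this] at hBk; omega
  by_cases hz : ∃ z, B z = 0
  · obtain ⟨z, hz⟩ := hz
    have : {i | P i = 1} ⊆ {z, z + 1} := by
      intro i hi
      simp only [Set.mem_ofPred_eq] at hi
      have h1 := hB (i - 1)
      rw [sub_add_cancel] at h1
      by_cases h0 : B i = 0
      · left; exact huniq _ _ h0 hz
      · right
        have : i - 1 = z := huniq _ _ (by have := bB i; omega) hz
        simp [← this]
    exact (Set.ncard_le_ncard this (Set.toFinite _)).trans (Set.ncard_insert_le _ _ |>.trans (by simp))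
  · push Not at hz
    have : {i | P i = 1} = ∅ := by
      ext i
      simp only [Set.mem_ofPred_eq, Set.mem_empty_iff_false, iff_false]
      intro hi
      have h1 := hB (i - 1)
      rw [sub_add_cancel] at h1
      have := hz i; have := hz (i - 1)
      omega
    rw [this]; simp

section prism
variable {n : ℕ} {S : Finset (PV n)} {orient : PV n → Bool}

/-- right neighbour -/
def rn (u : PV n) : PV n := (u.1 + 1, u.2)
/-- left neighbour -/
def ln (u : PV n) : PV n := (u.1 - 1, u.2)
/-- pillar neighbour -/
def pn (u : PV n) : PV n := (u.1, !u.2)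

lemma zmod_ne (hn : 3 ≤ n) : (1 : ZMod n) ≠ 0 ∧ (2 : ZMod n) ≠ 0 := by
  constructor
  · intro h
    have : ((1 : ℕ) : ZMod n) = 0 := by simpa using h
    rw [ZMod.natCast_eq_zero_iff] at this
    have := Nat.le_of_dvd (by norm_num) this
    omega
  · intro h
    have : ((2 : ℕ) : ZMod n) = 0 := by simpa using h
    rw [ZMod.natCast_eq_zero_iff] at this
    have := Nat.le_of_dvd (by norm_num) this
    omega

lemma zmod_sub_ne (hn : 3 ≤ n) (i : ZMod n) : i - 1 ≠ i + 1 := by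
  intro h
  apply (zmod_ne hn).2
  have : (2 : ZMod n) = (i + 1) - (i - 1) := by ring
  rw [this, h]; ring

lemma prism_adj (hn : 3 ≤ n) (u w : PV n) :
    (prismG n).Adj u w ↔ w = rn u ∨ w = ln u ∨ w = pn u := by
  obtain ⟨i, b⟩ := u
  obtain ⟨j, c⟩ := w
  have h1 := (zmod_ne hn).1
  simp only [prismG, SimpleGraph.fromRel_adj, rn, ln, pn, Prod.mk.injEq, ne_eq]
  constructor
  · rintro ⟨-, (⟨h, h'⟩ | ⟨h, h'⟩) | (⟨h, h'⟩ | ⟨h, h'⟩)⟩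
    · right; right; subst h; cases b <;> cases c <;> simp_all
    · left; exact ⟨h', h.symm⟩
    · right; right; subst h; cases b <;> cases c <;> simp_all
    · right; left; exact ⟨by rw [h']; ring, h⟩
  · rintro (⟨h, h'⟩ | ⟨h, h'⟩ | ⟨h, h'⟩) <;> subst h h' <;> simp [h1]
    intro h; apply h1; have := congrArg (i - ·) h; simpa using this.symm

lemma port_out {u w : PV n} (h : u ∉ S) : port S orient u w = 0 := by simp [port, h]
lemma port_pn {u : PV n} (h : u ∈ S) : port S orient u (pn u) = 2 := by simp [port, h, pn]
lemma port_rn (hn : 3 ≤ n) {u : PV n} (h : u ∈ S) :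
    port S orient u (rn u) = if orient u then 0 else 1 := by
  have h1 := (zmod_ne hn).1
  simp [port, h, rn, h1]
lemma port_ln (hn : 3 ≤ n) {u : PV n} (h : u ∈ S) :
    port S orient u (ln u) = if orient u then 1 else 0 := by
  have h1 := (zmod_ne hn).1
  have h2 := zmod_sub_ne hn u.1
  have h3 : u.1 ≠ u.1 - 1 := by
    intro h; apply h1; have := congrArg (u.1 - ·) h; simpa using this.symm
  simp [port, h, ln, h2, h3]

lemma infl_adj_iff (x y : InflV n S) : (inflPrism n S orient).Adj x y ↔
    (x.val.1 = y.val.1 ∧ x.val.1 ∈ S ∧ TF.Adj x.val.2 y.val.2) ∨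
    ((prismG n).Adj x.val.1 y.val.1 ∧ x = liftV S orient x.val.1 y.val.1 ∧
      y = liftV S orient y.val.1 x.val.1) := by
  have key : ∀ x : InflV n S, ∀ w, x = liftV S orient x.val.1 w ↔
      x.val.2 = port S orient x.val.1 w := by
    rintro ⟨⟨u, k⟩, h⟩ w
    constructor
    · intro h
      exact congrArg (fun z => z.val.2) h
    · intro h
      apply Subtype.ext
      simp only [liftV] at h ⊢
      rw [← h]
  rw [key, key]
  simp only [inflPrism, SimpleGraph.fromRel_adj]
  constructor
  · rintro ⟨-, (h | h) | (h | h)⟩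
    · exact Or.inl h
    · exact Or.inr h.2
    · exact Or.inl ⟨h.1.symm, h.1 ▸ h.2.1, h.2.2.symm⟩
    · exact Or.inr ⟨h.2.1.symm, h.2.2.2, h.2.2.1⟩
  · rintro (h | h)
    · refine ⟨?_, Or.inl (Or.inl h)⟩
      rintro rfl
      exact h.2.2.ne rfl
    · refine ⟨?_, Or.inl (Or.inr ⟨h.1.ne, h⟩)⟩
      rintro rfl
      exact h.1.ne rfl

/-! ### Hamiltonian path -/

/-- There is a path with given ends and vertex set. -/
def HasPath {V : Type*} (G : SimpleGraph V) (A : Set V) (u w : V) : Prop :=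
  ∃ p : G.Walk u w, p.IsPath ∧ ∀ x, x ∈ p.support ↔ x ∈ A

lemma HasPath.symm {V : Type*} {G : SimpleGraph V} {A : Set V} {u w : V}
    (h : HasPath G A u w) : HasPath G A w u := by
  obtain ⟨p, hp, hs⟩ := h
  exact ⟨p.reverse, hp.reverse, by simpa using hs⟩

lemma HasPath.append {V : Type*} {G : SimpleGraph V} {A B D : Set V} {u v v' w : V}
    (h : HasPath G A u v) (h' : HasPath G B v' w) (ha : G.Adj v v')
    (hd : ∀ x, x ∈ A → x ∉ B) (hD : ∀ x, x ∈ D ↔ x ∈ A ∨ x ∈ B) : HasPath G D u w := by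
  obtain ⟨p, hp, hs⟩ := h
  obtain ⟨q, hq, hs'⟩ := h'
  refine ⟨p.append (SimpleGraph.Walk.cons ha q), ?_, ?_⟩
  · rw [SimpleGraph.Walk.isPath_def, SimpleGraph.Walk.support_append,
      SimpleGraph.Walk.support_cons, List.tail_cons, List.nodup_append]
    refine ⟨hp.support_nodup, hq.support_nodup, ?_⟩
    rintro a ha b hb rfl
    exact hd a ((hs a).1 ha) ((hs' a).1 hb)
  · intro x
    rw [SimpleGraph.Walk.support_append, SimpleGraph.Walk.support_cons, List.tail_cons,
      List.mem_append, hs, hs', hD]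

lemma HasPath.ofList {V : Type*} {G : SimpleGraph V} (l : List V) (hne : l ≠ [])
    (hc : l.IsChain G.Adj) (hd : l.Nodup) (h : ∀ x, x ∈ l) :
    HasPath G Set.univ (l.head hne) (l.getLast hne) :=
  ⟨SimpleGraph.Walk.ofSupport l hne hc,
    by rw [SimpleGraph.Walk.isPath_def, SimpleGraph.Walk.support_ofSupport]; exact hd,
    by intro x; rw [SimpleGraph.Walk.support_ofSupport]; simp [h x]⟩

lemma tf_path0 : HasPath TF Set.univ 0 2 :=
  HasPath.ofList [0, 4, 9, 3, 14, 1, 7, 10, 12, 11, 5, 6, 13, 8, 2] (by simp)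
    (by decide) (by decide) (by decide)

lemma tf_path1 : HasPath TF Set.univ 1 2 :=
  HasPath.ofList [1, 7, 8, 13, 12, 10, 3, 14, 0, 4, 9, 11, 5, 6, 2] (by simp)
    (by decide) (by decide) (by decide)

/-- Fragment vertex. -/
def mkV (u : PV n) (hu : u ∈ S) (k : Fin 15) : InflV n S := ⟨(u, k), Or.inl hu⟩

/-- Embedding of the fragment. -/
def fragHom (orient : PV n → Bool) (u : PV n) (hu : u ∈ S) : TF →g inflPrism n S orient where
  toFun k := mkV u hu k
  map_rel' := by
    intro a b h
    exact (infl_adj_iff _ _).2 (Or.inl ⟨rfl, hu, h⟩)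

lemma frag_path (u : PV n) (hu : u ∈ S) {i j : Fin 15} (h : HasPath TF Set.univ i j) :
    HasPath (inflPrism n S orient) {x | x.val.1 = u} (mkV u hu i) (mkV u hu j) := by
  obtain ⟨p, hp, hs⟩ := h
  refine ⟨p.map (fragHom orient u hu), ?_, ?_⟩
  · apply SimpleGraph.Walk.IsPath.map _ hp
    intro a b h
    exact congrArg (fun z => z.val.2) h
  · intro x
    refine (by rw [SimpleGraph.Walk.support_map, List.mem_map] :
      x ∈ (p.map (fragHom orient u hu)).support ↔
        ∃ a ∈ p.support, fragHom orient u hu a = x).trans ?_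
    change _ ↔ x.val.1 = u
    constructor
    · rintro ⟨a, -, rfl⟩; rfl
    · rintro rfl
      exact ⟨x.val.2, by simp [hs], rfl⟩

lemma liftV_eq {u w : PV n} (hu : u ∈ S) {k : Fin 15} (h : port S orient u w = k) :
    liftV S orient u w = mkV u hu k := by
  apply Subtype.ext; simp [liftV, mkV, h]

lemma vert_path (hn : 3 ≤ n) (u w : PV n) (hw : w = rn u ∨ w = ln u) :
    HasPath (inflPrism n S orient) {x | x.val.1 = u} (liftV S orient u w)
      (liftV S orient u (pn u)) := by
  by_cases hu : u ∈ S
  · rw [liftV_eq hu (port_pn hu)]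
    have : port S orient u w = 0 ∨ port S orient u w = 1 := by
      rcases hw with rfl | rfl
      · rw [port_rn hn hu]; split_ifs <;> simp
      · rw [port_ln hn hu]; split_ifs <;> simp
    rcases this with h | h
    · rw [liftV_eq hu h]; exact frag_path u hu tf_path0
    · rw [liftV_eq hu h]; exact frag_path u hu tf_path1
  · have : liftV S orient u w = liftV S orient u (pn u) := by
      apply Subtype.ext; simp [liftV, port_out hu]
    rw [this]
    refine ⟨SimpleGraph.Walk.nil, by simp, ?_⟩
    intro x
    simp only [SimpleGraph.Walk.support_nil, List.mem_singleton, Set.mem_ofPred_eq]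
    constructor
    · rintro rfl; rfl
    · rintro rfl
      apply Subtype.ext
      have := x.property.resolve_left hu
      apply Prod.ext
      · rfl
      · rw [this]; simp [liftV, port_out hu]

lemma lift_adj (u w : PV n) (h : (prismG n).Adj u w) :
    (inflPrism n S orient).Adj (liftV S orient u w) (liftV S orient w u) := by
  rw [infl_adj_iff]
  exact Or.inr ⟨h, rfl, rfl⟩

lemma pillar_path (hn : 3 ≤ n) (i : ZMod n) (b : Bool) :
    HasPath (inflPrism n S orient) {x | x.val.1.1 = i} (liftV S orient (i, b) (ln (i, b)))
      (liftV S orient (i, !b) (rn (i, !b))) := by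
  have h1 := vert_path (S := S) (orient := orient) hn (i, b) _ (Or.inr rfl)
  have h2 := (vert_path (S := S) (orient := orient) hn (i, !b) _ (Or.inl rfl)).symm
  refine h1.append h2 ?_ ?_ ?_
  · have : pn (i, !b) = (i, b) := by simp [pn]
    rw [this]
    have := lift_adj (S := S) (orient := orient) (i, b) (pn (i, b))
      ((prism_adj hn _ _).2 (Or.inr (Or.inr rfl)))
    exact this
  · intro x h h'
    simp only [Set.mem_ofPred_eq] at h h'
    rw [h] at h'
    simp at h'
  · intro x
    change x.val.1.1 = i ↔ x.val.1 = (i, b) ∨ x.val.1 = (i, !b)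
    generalize x.val.1 = z
    obtain ⟨j, c⟩ := z
    simp only [Prod.mk.injEq]
    cases b <;> cases c <;> simp

lemma upto_path (hn : 3 ≤ n) (m : ℕ) (hm : m < n) : ∃ b,
    HasPath (inflPrism n S orient) {x | x.val.1.1.val ≤ m}
      (liftV S orient (0, false) (ln (0, false)))
      (liftV S orient ((m : ZMod n), b) (rn ((m : ZMod n), b))) := by
  have : NeZero n := ⟨by omega⟩
  induction m with
  | zero =>
    refine ⟨true, ?_⟩
    have := pillar_path (S := S) (orient := orient) hn 0 false
    simpa [ZMod.val_eq_zero] using this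
  | succ m ih =>
    obtain ⟨b, hb⟩ := ih (by omega)
    refine ⟨!b, ?_⟩
    have hv : ((m + 1 : ℕ) : ZMod n).val = m + 1 := ZMod.val_cast_of_lt hm
    refine hb.append (pillar_path hn ((m + 1 : ℕ) : ZMod n) b) ?_ ?_ ?_
    · have e1 : rn ((m : ZMod n), b) = (((m + 1 : ℕ) : ZMod n), b) := by simp [rn]
      have e2 : ln (((m + 1 : ℕ) : ZMod n), b) = ((m : ZMod n), b) := by simp [ln]
      rw [e1, e2]
      apply lift_adj
      rw [prism_adj hn, e1]
      exact Or.inl rfl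
    · intro x h h'
      simp only [Set.mem_ofPred_eq] at h h'
      rw [h', hv] at h
      omega
    · intro x
      simp only [Set.mem_ofPred_eq]
      rw [← (ZMod.val_injective n).eq_iff (b := ((m + 1 : ℕ) : ZMod n)), hv]
      omega

lemma ham_path (hn : 3 ≤ n) :
    ∃ (x y : InflV n S) (p : (inflPrism n S orient).Walk x y), p.IsHamiltonian := by
  have : NeZero n := ⟨by omega⟩
  obtain ⟨b, p, hp, hs⟩ := upto_path (S := S) (orient := orient) hn (n - 1) (by omega)
  refine ⟨_, _, p, hp.isHamiltonian_of_mem ?_⟩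
  intro w
  rw [hs]
  have := ZMod.val_lt w.val.1.1
  simp only [Set.mem_ofPred_eq]
  omega

/-! ### No Hamiltonian cycle -/

lemma rn_ne_ln (hn : 3 ≤ n) (u : PV n) : rn u ≠ ln u := by
  intro h
  exact zmod_sub_ne hn u.1 (congrArg Prod.fst h).symm
lemma rn_ne_pn (u : PV n) : rn u ≠ pn u := by
  intro h
  have := congrArg Prod.snd h
  simp [rn, pn] at this
lemma ln_ne_pn (u : PV n) : ln u ≠ pn u := by
  intro h
  have := congrArg Prod.snd h
  simp [ln, pn] at this

lemma liftV_ne {u v w : PV n} (h : v ≠ w) : liftV S orient v u ≠ liftV S orient w u := by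
  intro h'
  exact h (congrArg (fun z => z.val.1) h')

lemma vertex_key (hn : 3 ≤ n) (E : InflV n S → InflV n S → Prop)
    (hsymm : ∀ u v, E u v → E v u) (hadj : ∀ u v, E u v → (inflPrism n S orient).Adj u v)
    (hdeg : ∀ u, {v | E u v}.ncard = 2)
    (hcut : ∀ W : Set (InflV n S), ∀ a b, a ∈ W → b ∉ W → ∃ u v, u ∈ W ∧ v ∉ W ∧ E u v)
    (Q : PV n → PV n → Prop) (hQ : ∀ u w, Q u w ↔ E (liftV S orient u w) (liftV S orient w u))
    (u : PV n) :
    ind (Q u (rn u)) + ind (Q u (ln u)) + ind (Q u (pn u)) = 2 ∧ (u ∈ S → Q u (pn u)) := by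
  by_cases hu : u ∈ S
  · have main : ∀ wa wb : PV n, ((wa = rn u ∧ wb = ln u) ∨ (wa = ln u ∧ wb = rn u)) →
        port S orient u wa = 0 → port S orient u wb = 1 →
        ind (Q u (pn u)) = 1 ∧ ind (Q u wa) + ind (Q u wb) = 1 := by
      intro wa wb hw ha hb
      have hc : port S orient u (pn u) = 2 := port_pn hu
      have hpa : (prismG n).Adj u wa := by rw [prism_adj hn]; tauto
      have hpb : (prismG n).Adj u wb := by rw [prism_adj hn]; tauto
      have hpc : (prismG n).Adj u (pn u) := by rw [prism_adj hn]; tauto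
      let f : Fin 15 → InflV n S := fun k => mkV u hu k
      have finj : ∀ i j, i ≠ j → f i ≠ f j := by
        intro i j h h'
        exact h (congrArg (fun z => z.val.2) h')
      have fne : ∀ i w, (prismG n).Adj u w → f i ≠ liftV S orient w u := by
        intro i w h h'
        exact h.ne (congrArg (fun z => z.val.1) h')
      have nb : ∀ k y, E (f k) y → (∃ j, y = f j ∧ TF.Adj k j) ∨
          (k = 0 ∧ y = liftV S orient wa u) ∨ (k = 1 ∧ y = liftV S orient wb u) ∨
          (k = 2 ∧ y = liftV S orient (pn u) u) := by
        intro k y h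
        rcases (infl_adj_iff _ _).1 (hadj _ _ h) with ⟨h1, -, h3⟩ | ⟨h1, h2, h3⟩
        · left
          refine ⟨y.val.2, ?_, h3⟩
          apply Subtype.ext
          exact Prod.ext h1.symm rfl
        · right
          have h2' : k = port S orient u y.val.1 := congrArg (fun z => z.val.2) h2
          have h3' : y = liftV S orient y.val.1 u := h3
          have h1' : y.val.1 = wa ∨ y.val.1 = wb ∨ y.val.1 = pn u := by
            have := (prism_adj hn u y.val.1).1 h1
            rcases hw with ⟨rfl, rfl⟩ | ⟨rfl, rfl⟩ <;> tauto
          rcases h1' with h | h | h <;> rw [h] at h2' h3'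
          · exact Or.inl ⟨h2'.trans ha, h3'⟩
          · exact Or.inr (Or.inl ⟨h2'.trans hb, h3'⟩)
          · exact Or.inr (Or.inr ⟨h2'.trans hc, h3'⟩)
      have la : liftV S orient u wa = f 0 := liftV_eq hu ha
      have lb : liftV S orient u wb = f 1 := liftV_eq hu hb
      have lc : liftV S orient u (pn u) = f 2 := liftV_eq hu hc
      have qa : Q u wa ↔ E (f 0) (liftV S orient wa u) := by rw [hQ, la]
      have qb : Q u wb ↔ E (f 1) (liftV S orient wb u) := by rw [hQ, lb]
      have qc : Q u (pn u) ↔ E (f 2) (liftV S orient (pn u) u) := by rw [hQ, lc]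
      have t0 : ∀ m, TF.Adj 0 m → m = 4 ∨ m = 14 := by decide
      have t1 : ∀ m, TF.Adj 1 m → m = 7 ∨ m = 14 := by decide
      have t2 : ∀ m, TF.Adj 2 m → m = 6 ∨ m = 8 := by decide
      have := tf_key (fun i j => E (f i) (f j)) (fun i j => hsymm _ _)
        (by
          intro i j h
          rcases nb i _ h with ⟨j', h1, h2⟩ | ⟨-, h1⟩ | ⟨-, h1⟩ | ⟨-, h1⟩
          · have : j = j' := by
              by_contra hne
              exact finj _ _ hne h1
            rwa [this]
          · exact absurd h1 (fne _ _ hpa)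
          · exact absurd h1 (fne _ _ hpb)
          · exact absurd h1 (fne _ _ hpc))
        (ind (Q u wa)) (ind (Q u wb)) (ind (Q u (pn u))) (ind_le _) (ind_le _) (ind_le _)
        (by
          intro k i j l hij hil hjl hk hm
          apply deg_lemma (E (f k)) (f i) (f j) (f l) (finj _ _ hij) (finj _ _ hil)
            (finj _ _ hjl) (hdeg _)
          intro y hy
          rcases nb k y hy with ⟨m, rfl, h2⟩ | ⟨rfl, -⟩ | ⟨rfl, -⟩ | ⟨rfl, -⟩
          · rcases hm m h2 with rfl | rfl | rfl <;> simp
          · exact absurd hk (by decide)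
          · exact absurd hk (by decide)
          · exact absurd hk (by decide))
        (by
          rw [qa]
          apply deg_lemma (E (f 0)) _ _ _ (finj _ _ (by decide)) (fne _ _ hpa) (fne _ _ hpa)
            (hdeg _)
          intro y hy
          rcases nb _ y hy with ⟨m, rfl, h2⟩ | ⟨h, h'⟩ | ⟨h, -⟩ | ⟨h, -⟩
          · rcases t0 m h2 with rfl | rfl <;> simp
          · exact Or.inr (Or.inr h')
          · exact absurd h (by decide)
          · exact absurd h (by decide))
        (by
          rw [qb]
          apply deg_lemma (E (f 1)) _ _ _ (finj _ _ (by decide)) (fne _ _ hpb) (fne _ _ hpb)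
            (hdeg _)
          intro y hy
          rcases nb _ y hy with ⟨m, rfl, h2⟩ | ⟨h, -⟩ | ⟨h, h'⟩ | ⟨h, -⟩
          · rcases t1 m h2 with rfl | rfl <;> simp
          · exact absurd h (by decide)
          · exact Or.inr (Or.inr h')
          · exact absurd h (by decide))
        (by
          rw [qc]
          apply deg_lemma (E (f 2)) _ _ _ (finj _ _ (by decide)) (fne _ _ hpc) (fne _ _ hpc)
            (hdeg _)
          intro y hy
          rcases nb _ y hy with ⟨m, rfl, h2⟩ | ⟨h, -⟩ | ⟨h, -⟩ | ⟨h, h'⟩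
          · rcases t2 m h2 with rfl | rfl <;> simp
          · exact absurd h (by decide)
          · exact absurd h (by decide)
          · exact Or.inr (Or.inr h'))
        (by
          rintro W ⟨i0, hi0⟩ wa0 wb0 wc0
          obtain ⟨x, y, ⟨i, hi, rfl⟩, hy, hxy⟩ := hcut {x | ∃ i ∈ W, f i = x} (f i0)
            (liftV S orient (pn u) u) ⟨i0, hi0, rfl⟩ (by
              rintro ⟨i, -, h⟩
              exact fne _ _ hpc h)
          rcases nb i y hxy with ⟨j, rfl, -⟩ | ⟨rfl, rfl⟩ | ⟨rfl, rfl⟩ | ⟨rfl, rfl⟩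
          · exact ⟨i, j, hi, fun h => hy ⟨j, h, rfl⟩, hxy⟩
          · exact absurd (qa.2 hxy) (ind_zero.1 (wa0 hi))
          · exact absurd (qb.2 hxy) (ind_zero.1 (wb0 hi))
          · exact absurd (qc.2 hxy) (ind_zero.1 (wc0 hi)))
      exact this
    have hr := port_rn (orient := orient) hn hu
    have hl := port_ln (orient := orient) hn hu
    by_cases ho : orient u = true
    · rw [if_pos ho] at hr hl
      have := main (rn u) (ln u) (Or.inl ⟨rfl, rfl⟩) hr hl
      exact ⟨by omega, fun _ => ind_one.1 this.1⟩
    · rw [if_neg ho] at hr hl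
      have := main (ln u) (rn u) (Or.inr ⟨rfl, rfl⟩) hl hr
      exact ⟨by omega, fun _ => ind_one.1 this.1⟩
  · refine ⟨?_, fun h => absurd h hu⟩
    have e : ∀ w, liftV S orient u w = ⟨(u, 0), Or.inr rfl⟩ := by
      intro w; apply Subtype.ext; simp [liftV, port_out hu]
    rw [hQ, hQ, hQ, e, e, e]
    apply deg_lemma (E ⟨(u, 0), Or.inr rfl⟩) _ _ _ (liftV_ne (rn_ne_ln hn u))
      (liftV_ne (rn_ne_pn u)) (liftV_ne (ln_ne_pn u)) (hdeg _)
    intro y hy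
    rcases (infl_adj_iff _ _).1 (hadj _ _ hy) with ⟨-, h, -⟩ | ⟨h1, -, h3⟩
    · exact absurd h hu
    · have h3' : y = liftV S orient y.val.1 u := h3
      rcases (prism_adj hn u y.val.1).1 h1 with h | h | h <;> rw [h] at h3' <;> tauto

lemma no_cycle (hn : 3 ≤ n) (hodd : Odd n) (hpil : 3 ≤ (inflatedPillars S).ncard) :
    ¬ ∃ (x : InflV n S) (C : (inflPrism n S orient).Walk x x), C.IsHamiltonianCycle := by
  rintro ⟨x, C, hC⟩
  have : NeZero n := ⟨by omega⟩
  obtain ⟨E, hsymm, hadj, hdeg, hcut⟩ := ham_facts C hC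
  let Q : PV n → PV n → Prop := fun u w => E (liftV S orient u w) (liftV S orient w u)
  have key := vertex_key hn E hsymm hadj hdeg hcut Q (fun _ _ => Iff.rfl)
  have qs : ∀ u w, ind (Q u w) = ind (Q w u) := by
    intro u w
    congr 1
    exact propext ⟨hsymm _ _, hsymm _ _⟩
  have hle := prism_final n hn hodd (fun i => ind (Q (i, false) (i + 1, false)))
    (fun i => ind (Q (i, true) (i + 1, true))) (fun i => ind (Q (i, false) (i, true)))
    (fun _ => ind_le _) (fun _ => ind_le _) (fun _ => ind_le _)
    (by
      intro i
      have := (key (i + 1, false)).1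
      simp only [rn, ln, pn, add_sub_cancel_right, Bool.not_false] at this
      rw [qs (i + 1, false) (i, false)] at this
      exact this)
    (by
      intro i
      have := (key (i + 1, true)).1
      simp only [rn, ln, pn, add_sub_cancel_right, Bool.not_true] at this
      rw [qs (i + 1, true) (i, true), qs (i + 1, true) (i + 1, false)] at this
      exact this)
    (by
      intro A a b ha hb
      obtain ⟨x, y, hx, hy, hxy⟩ := hcut {x | x.val.1.1 ∈ A}
        (liftV S orient (a, false) (a, false)) (liftV S orient (b, false) (b, false)) ha hb
      simp only [Set.mem_ofPred_eq] at hx hy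
      rcases (infl_adj_iff _ _).1 (hadj _ _ hxy) with ⟨h, -, -⟩ | ⟨h1, h2, h3⟩
      · rw [h] at hx; exact absurd hx hy
      have hq : Q x.val.1 y.val.1 := by
        change E _ _
        rw [← h2, ← h3]; exact hxy
      clear h2 h3 hxy
      generalize x.val.1 = u at *
      generalize y.val.1 = w at *
      obtain ⟨i, c⟩ := u
      rcases (prism_adj hn _ _).1 h1 with rfl | rfl | rfl
      · refine ⟨i, Or.inl ⟨hx, hy⟩, ?_⟩
        cases c
        · exact Or.inl (ind_pos hq)
        · exact Or.inr (ind_pos hq)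
      · refine ⟨i - 1, Or.inr ⟨hy, by simpa using hx⟩, ?_⟩
        have hq' := hsymm _ _ hq
        cases c
        · left; apply ind_pos; rw [sub_add_cancel]; exact hq'
        · right; apply ind_pos; rw [sub_add_cancel]; exact hq'
      · exact absurd hx hy)
  have hsub : inflatedPillars S ⊆ {i | ind (Q (i, false) (i, true)) = 1} := by
    intro i hi
    rcases hi with h | h
    · exact ind_pos ((key (i, false)).2 h)
    · exact ind_pos (hsymm _ _ ((key (i, true)).2 h))
  have := Set.ncard_le_ncard hsub (Set.toFinite _)
  omega

end prism

/-- Let `G` be obtained from `C_n □ K_2` with `n` odd by TF-inflations at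
vertices lying on at least three distinct pillars.  Then `G` is non-hamiltonian but has a
hamiltonian path. -/
theorem stmt10 (n : ℕ) (hn : 3 ≤ n) (hodd : Odd n) (S : Finset (PV n))
    (orient : PV n → Bool) (hpil : 3 ≤ (inflatedPillars S).ncard) :
    (¬ ∃ (x : InflV n S) (C : (inflPrism n S orient).Walk x x), C.IsHamiltonianCycle) ∧
    (∃ (x y : InflV n S) (p : (inflPrism n S orient).Walk x y), p.IsHamiltonian) := by
  exact ⟨no_cycle hn hodd hpil, ham_path hn⟩
end

section
/- Let G be obtained from the prism C_n □ K_2, n even, by applying TF-inflations on vertices of at least 3 distinct pillars. Then every hamiltonian cycle of G, after contracting all edges lying inside the inserted Tutte Fragments, yields one of the two meandering hamiltonian cycles of C_n □ K_2. -/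
open SimpleGraph

def two (a b c : Bool) : Bool := (a && b && !c) || (a && !b && c) || (!a && b && c)

set_option maxRecDepth 100000 in
lemma frag_bool : ∀ e0_4 e0_14 pa : Bool, two e0_4 e0_14 pa = true →
  ∀ e14_1 e3_14 : Bool, two e0_14 e14_1 e3_14 = true →
  ∀ e1_7 pb : Bool, two e1_7 e14_1 pb = true →
  ∀ e7_8 e10_7 : Bool, two e1_7 e7_8 e10_7 = true →
  ∀ e4_5 e4_9 : Bool, two e0_4 e4_5 e4_9 = true →
  ∀ e9_3 e3_10 : Bool, two e9_3 e3_10 e3_14 = true →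
  ∀ e11_9 : Bool, two e4_9 e9_3 e11_9 = true →
  ∀ e12_10 : Bool, two e3_10 e10_7 e12_10 = true →
  ∀ e5_6 e5_11 : Bool, two e4_5 e5_6 e5_11 = true →
  ∀ e11_12 : Bool, two e5_11 e11_12 e11_9 = true →
  ∀ e13_12 : Bool, two e11_12 e13_12 e12_10 = true →
  ∀ e8_2 e13_8 : Bool, two e7_8 e8_2 e13_8 = true →
  ∀ e6_13 : Bool, two e6_13 e13_8 e13_12 = true →
  ∀ e6_2 : Bool, two e5_6 e6_2 e6_13 = true →
  ∀ pc : Bool, two e6_2 e8_2 pc = true →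
  (two pa pb pc && pc) = true ∨
  (!pa && !pb && !pc) = true ∨
  (!e0_4 && !e1_7 && !e3_14 && !pc) = true ∨
  (!e0_4 && !e5_6 && !e9_3 && !e11_12) = true ∨
  (!e0_4 && !e7_8 && !e9_3 && !e12_10 && !pc) = true ∨
  (!e5_6 && !e7_8 && !e13_12 && !pc) = true ∨
  (!e5_6 && !e1_7 && !e3_10 && !e11_12 && !pc) = true := by decide

lemma frag (E : Fin 15 → Fin 15 → Bool) (pa pb pc : Bool)
    (h0 : two (E 0 4) (E 0 14) pa = true)
    (h1 : two (E 1 7) (E 14 1) pb = true)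
    (h2 : two (E 6 2) (E 8 2) pc = true)
    (h3 : two (E 9 3) (E 3 10) (E 3 14) = true)
    (h4 : two (E 0 4) (E 4 5) (E 4 9) = true)
    (h5 : two (E 4 5) (E 5 6) (E 5 11) = true)
    (h6 : two (E 5 6) (E 6 2) (E 6 13) = true)
    (h7 : two (E 1 7) (E 7 8) (E 10 7) = true)
    (h8 : two (E 7 8) (E 8 2) (E 13 8) = true)
    (h9 : two (E 4 9) (E 9 3) (E 11 9) = true)
    (h10 : two (E 3 10) (E 10 7) (E 12 10) = true)
    (h11 : two (E 5 11) (E 11 12) (E 11 9) = true)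
    (h12 : two (E 11 12) (E 13 12) (E 12 10) = true)
    (h13 : two (E 6 13) (E 13 8) (E 13 12) = true)
    (h14 : two (E 0 14) (E 14 1) (E 3 14) = true) :
    (two pa pb pc = true ∧ pc = true) ∨
    ∃ K : List (Fin 15), K ≠ [] ∧ (0 ∈ K → pa = false) ∧ (1 ∈ K → pb = false) ∧
      (2 ∈ K → pc = false) ∧
      ∀ q ∈ TFedges, (q.1 ∈ K ↔ q.2 ∈ K) ∨ E q.1 q.2 = false := by
  have := frag_bool (E 0 4) (E 0 14) pa h0 (E 14 1) (E 3 14) h14 (E 1 7) pb h1 (E 7 8) (E 10 7) h7 (E 4 5) (E 4 9) h4 (E 9 3) (E 3 10) h3 (E 11 9) h9 (E 12 10) h10 (E 5 6) (E 5 11) h5 (E 11 12) h11 (E 13 12) h12 (E 8 2) (E 13 8) h8 (E 6 13) h13 (E 6 2) h6 pc h2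
  rcases this with h | h | h | h | h | h | h
  · left; simpa using h
  · right; simp at h; exact ⟨List.finRange 15, by simp, by simp [h], by simp [h], by simp [h], by simp⟩
  · right; refine ⟨[2, 3, 4, 5, 6, 7, 8, 9, 10, 11, 12, 13], by simp, by simp, by simp, ?_, ?_⟩
    · simp at h ⊢; try simp [h]
    · simp at h; simp [TFedges, h]
  · right; refine ⟨[4, 5, 9, 11], by simp, by simp, by simp, ?_, ?_⟩
    · simp at h ⊢; try simp [h]
    · simp at h; simp [TFedges, h]
  · right; refine ⟨[2, 4, 5, 6, 8, 9, 11, 12, 13], by simp, by simp, by simp, ?_, ?_⟩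
    · simp at h ⊢; try simp [h]
    · simp at h; simp [TFedges, h]
  · right; refine ⟨[2, 6, 8, 13], by simp, by simp, by simp, ?_, ?_⟩
    · simp at h ⊢; try simp [h]
    · simp at h; simp [TFedges, h]
  · right; refine ⟨[2, 6, 7, 8, 10, 12, 13], by simp, by simp, by simp, ?_, ?_⟩
    · simp at h ⊢; try simp [h]
    · simp at h; simp [TFedges, h]

lemma two_of_ncard {V : Type*} (D : SimpleGraph V) (d : V → V → Bool)
    (hd : ∀ x y, d x y = true ↔ D.Adj x y) (x p q r : V) (hpq : p ≠ q) (hpr : p ≠ r) (hqr : q ≠ r)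
    (h2 : (D.neighborSet x).ncard = 2) (hsub : ∀ y, D.Adj x y → y = p ∨ y = q ∨ y = r) :
    two (d x p) (d x q) (d x r) = true := by
  obtain ⟨s, t, hst, he⟩ := Set.ncard_eq_two.1 h2
  have hm : ∀ y, d x y = true ↔ y = s ∨ y = t := by
    intro y
    rw [hd, ← mem_neighborSet, he]; simp
  have hs := hsub s ((hd _ _).1 ((hm s).2 (Or.inl rfl)))
  have ht := hsub t ((hd _ _).1 ((hm t).2 (Or.inr rfl)))
  have hp := hm p
  have hq := hm q
  have hr := hm r
  unfold two
  grind

lemma ncard_of_two {V : Type*} (D : SimpleGraph V) (d : V → V → Bool)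
    (hd : ∀ x y, d x y = true ↔ D.Adj x y) (x p q r : V) (hpq : p ≠ q) (hpr : p ≠ r) (hqr : q ≠ r)
    (hsub : ∀ y, D.Adj x y → y = p ∨ y = q ∨ y = r)
    (h : two (d x p) (d x q) (d x r) = true) :
    (D.neighborSet x).ncard = 2 := by
  rw [Set.ncard_eq_two]
  have hp := hd x p
  have hq := hd x q
  have hr := hd x r
  by_cases h1 : D.Adj x p <;> by_cases h2 : D.Adj x q <;> by_cases h3 : D.Adj x r <;>
    simp only [h1, h2, h3, iff_true, iff_false, Bool.not_eq_true] at hp hq hr <;>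
    rw [hp, hq, hr] at h <;> first | exact absurd h (by decide) | skip
  · exact ⟨p, q, hpq, by ext y; simp; grind⟩
  · exact ⟨p, r, hpr, by ext y; simp; grind⟩
  · exact ⟨q, r, hqr, by ext y; simp; grind⟩

lemma closed_all {V : Type*} (D : SimpleGraph V) (hD : D.Preconnected) (P : V → Prop)
    (hP : ∀ x y, D.Adj x y → P x → P y) (x y : V) (hx : P x) : P y := by
  obtain ⟨p⟩ := hD x y
  induction p with
  | nil => exact hx
  | cons h p ih => exact ih (hP _ _ h hx)

section prism
variable {n : ℕ}

lemma one_ne (hn : 3 ≤ n) : (1 : ZMod n) ≠ 0 := by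
  have : Fact (1 < n) := ⟨by omega⟩
  exact one_ne_zero

lemma two_ne (hn : 3 ≤ n) : (1 : ZMod n) + 1 ≠ 0 := by
  intro h
  have : ((2 : ℕ) : ZMod n) = 0 := by push_cast; rw [← h]; norm_num
  rw [ZMod.natCast_eq_zero_iff] at this
  have := Nat.le_of_dvd (by norm_num) this
  omega

lemma prism_adj_s11 (hn : 3 ≤ n) (i : ZMod n) (b : Bool) (w : PV n) :
    (prismG n).Adj (i, b) w ↔ w = (i + 1, b) ∨ w = (i - 1, b) ∨ w = (i, !b) := by
  obtain ⟨j, c⟩ := w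
  have h1 := one_ne hn
  simp only [prismG, fromRel_adj, ne_eq, Prod.mk.injEq]
  constructor
  · rintro ⟨h, (⟨h2, h3⟩ | ⟨h2, h3⟩) | (⟨h2, h3⟩ | ⟨h2, h3⟩)⟩
    · right; right; refine ⟨h2.symm, ?_⟩; revert h3; cases b <;> cases c <;> simp
    · left; exact ⟨h3, h2.symm⟩
    · right; right; refine ⟨h2, ?_⟩; revert h3; cases b <;> cases c <;> simp
    · right; left; exact ⟨by rw [h3]; ring, h2⟩
  · rintro (⟨rfl, rfl⟩ | ⟨rfl, rfl⟩ | ⟨rfl, rfl⟩)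
    · simp [h1]
    · have : i ≠ i - 1 := fun h => h1 (by linear_combination h)
      simp [this]
    · simp

lemma prism_ne (hn : 3 ≤ n) (i : ZMod n) (b : Bool) :
    ((i + 1, b) : PV n) ≠ (i - 1, b) ∧ ((i + 1, b) : PV n) ≠ (i, !b) ∧
    ((i - 1, b) : PV n) ≠ (i, !b) := by
  refine ⟨?_, by simp, by simp⟩
  intro h
  have h := (Prod.mk.inj h).1
  apply two_ne hn
  linear_combination h

lemma ports (hn : 3 ≤ n) (S : Finset (PV n)) (orient : PV n → Bool) (i : ZMod n) (b : Bool)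
    (hS : (i, b) ∈ S) : ∃ w0 w1 : PV n,
    ((w0 = (i + 1, b) ∧ w1 = (i - 1, b)) ∨ (w0 = (i - 1, b) ∧ w1 = (i + 1, b))) ∧
    port S orient (i, b) w0 = 0 ∧ port S orient (i, b) w1 = 1 ∧
    port S orient (i, b) (i, !b) = 2 := by
  have h1 := one_ne hn
  have h2 : i - 1 ≠ i + 1 := by
    intro h; apply two_ne hn; linear_combination -h
  have h3 : i ≠ i - 1 := by
    intro h; apply h1; linear_combination h
  cases h : orient (i, b)
  · exact ⟨(i - 1, b), (i + 1, b), Or.inr ⟨rfl, rfl⟩, by simp [port, hS, h1, h2, h3, h]⟩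
  · exact ⟨(i + 1, b), (i - 1, b), Or.inl ⟨rfl, rfl⟩, by simp [port, hS, h1, h2, h3, h]⟩

lemma infl_adj (S : Finset (PV n)) (orient : PV n → Bool) (x y : InflV n S)
    (h : (inflPrism n S orient).Adj x y) :
    (x.val.1 = y.val.1 ∧ x.val.1 ∈ S ∧ TF.Adj x.val.2 y.val.2) ∨
    ((prismG n).Adj x.val.1 y.val.1 ∧ x = liftV S orient x.val.1 y.val.1 ∧
      y = liftV S orient y.val.1 x.val.1) := by
  simp only [inflPrism, fromRel_adj] at h
  obtain ⟨-, (⟨h1, h2, h3⟩ | ⟨h1, h2, h3, h4⟩) | (⟨h1, h2, h3⟩ | ⟨h1, h2, h3, h4⟩)⟩ := h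
  · exact Or.inl ⟨h1, h2, h3⟩
  · exact Or.inr ⟨h2, Subtype.ext (Prod.ext rfl h3), Subtype.ext (Prod.ext rfl h4)⟩
  · exact Or.inl ⟨h1.symm, h1 ▸ h2, h3.symm⟩
  · exact Or.inr ⟨h2.symm, Subtype.ext (Prod.ext rfl h4), Subtype.ext (Prod.ext rfl h3)⟩

/-- Column analysis. -/
lemma columns [NeZero n] (x y p : ZMod n → Bool)
    (hx : ∀ i, two (x i) (x (i - 1)) (p i) = true)
    (hy : ∀ i, two (y i) (y (i - 1)) (p i) = true)
    (hcut : ∀ g g', g ≠ g' → x g = false → y g = false → x g' = false → y g' = false → False)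
    (T : Set (ZMod n)) (hT : ∀ i ∈ T, p i = true) (h3 : 3 ≤ T.ncard) : ∀ i, p i = true := by
  by_cases hex : ∃ j, x j = y j
  · exfalso
    obtain ⟨j, hj⟩ := hex
    have hk : ∀ k : ℕ, x (j + k) = y (j + k) := by
      intro k
      induction k with
      | zero => simpa using hj
      | succ k ih =>
        have e : j + ((k + 1 : ℕ) : ZMod n) - 1 = j + k := by push_cast; ring
        have a := hx (j + (k + 1 : ℕ))
        have b := hy (j + (k + 1 : ℕ))
        rw [e] at a b
        unfold two at a b
        grind
    have hall : ∀ i, x i = y i := by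
      intro i
      have := hk (i - j).val
      rw [ZMod.natCast_zmod_val] at this
      simpa using this
    have hor : ∀ i ∈ T, x i = false ∨ x (i - 1) = false := by
      intro i hi
      have a := hx i
      have b := hT i hi
      unfold two at a
      grind
    have huniq : ∀ g g', x g = false → x g' = false → g = g' := by
      intro g g' h h'
      by_contra hne
      exact hcut g g' hne h (hall g ▸ h) h' (hall g' ▸ h')
    have : ∃ g, T ⊆ {g, g + 1} := by
      obtain ⟨i, hi⟩ := Set.nonempty_of_ncard_ne_zero (s := T) (by omega)
      obtain ⟨g, hg⟩ : ∃ g, x g = false := by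
        rcases hor i hi with h | h
        · exact ⟨_, h⟩
        · exact ⟨_, h⟩
      refine ⟨g, fun k hk => ?_⟩
      rcases hor k hk with h | h
      · left; exact huniq _ _ h hg
      · right; rw [← huniq _ _ h hg]; simp
    obtain ⟨g, hg⟩ := this
    have := (Set.ncard_le_ncard hg).trans (Set.ncard_insert_le _ _)
    rw [Set.ncard_singleton] at this
    omega
  · push Not at hex
    intro i
    have a := hx i
    have b := hy i
    have c := hex i
    unfold two at a b
    grind

lemma cut_step [NeZero n] (hn : 3 ≤ n) (g g' i : ZMod n) (h : i ≠ g) (h' : i ≠ g') :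
    (i - (g + 1)).val < (g' - g).val ↔ (i + 1 - (g + 1)).val < (g' - g).val := by
  set t := i - (g + 1) with ht
  have e : i + 1 - (g + 1) = t + 1 := by rw [ht]; ring
  rw [e]
  have hlt := ZMod.val_lt t
  have h1 : t.val + 1 < n := by
    by_contra hc
    have : t.val + 1 = n := by omega
    have h2 : ((t.val + 1 : ℕ) : ZMod n) = 0 := by rw [this]; simp
    push_cast at h2
    rw [ZMod.natCast_zmod_val] at h2
    apply h; rw [ht] at h2; linear_combination h2
  have h2 : (t + 1).val = t.val + 1 := by
    have : Fact (1 < n) := ⟨by omega⟩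
    rw [ZMod.val_add_of_lt] <;> rw [ZMod.val_one]
    exact h1
  rw [h2]
  have h3 : t.val + 1 ≠ (g' - g).val := by
    rw [← h2]
    intro hc
    have := ZMod.val_injective n hc
    apply h'; rw [ht] at this; linear_combination this
  omega

/-- Abstract version on the prism. -/
lemma prism_main (hn : 3 ≤ n) (F : SimpleGraph (PV n)) (hle : F ≤ prismG n)
    (hconn : F.Preconnected) (f : PV n → PV n → Bool) (hf : ∀ u w, f u w = true ↔ F.Adj u w)
    (htwo : ∀ i b, two (f (i, b) (i + 1, b)) (f (i, b) (i - 1, b)) (f (i, b) (i, !b)) = true)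
    (T : Set (ZMod n)) (hT : ∀ i ∈ T, F.Adj (i, false) (i, true)) (h3 : 3 ≤ T.ncard) :
    ∃ (v : PV n) (H : (prismG n).Walk v v), H.IsHamiltonianCycle ∧ Meandering H ∧
      ∀ u w : PV n, s(u, w) ∈ H.edges ↔ F.Adj u w := by
  have : NeZero n := ⟨by omega⟩
  have hsym : ∀ u w, f u w = f w u := by
    intro u w
    rw [Bool.eq_iff_iff, hf, hf, F.adj_comm]
  have hdeg : ∀ u, (F.neighborSet u).ncard = 2 := by
    rintro ⟨i, b⟩
    obtain ⟨n1, n2, n3⟩ := prism_ne hn i b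
    exact ncard_of_two F f hf _ _ _ _ n1 n2 n3
      (fun y hy => (prism_adj_s11 hn i b y).1 (hle hy)) (htwo i b)
  have hcyc : F.IsCycles := fun u _ => hdeg u
  -- cycle
  let v : PV n := (0, false)
  obtain ⟨H0, hH0, hv0⟩ := hcyc.exists_cycle_toSubgraph_verts_eq_connectedComponentSupp
    (v := v) (c := F.connectedComponentMk v) (by simp)
    (Set.nonempty_of_ncard_ne_zero (by rw [hdeg]; norm_num))
  have hall : ∀ u, u ∈ H0.toSubgraph.verts := by
    intro u
    rw [hv0]
    exact ConnectedComponent.sound (hconn u v)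
  have hedge : ∀ u w, s(u, w) ∈ H0.edges ↔ F.Adj u w := by
    intro u w
    rw [← Walk.adj_toSubgraph_iff_mem_edges]
    classical
    let _ : F.LocallyFinite := fun _ => Fintype.ofFinite _
    exact hH0.adj_toSubgraph_iff_of_isCycles hcyc (hall u) w
  -- all pillars
  have hpil : ∀ i, f (i, false) (i, true) = true := by
    refine columns (fun i => f (i, false) (i + 1, false)) (fun i => f (i, true) (i + 1, true))
      (fun i => f (i, false) (i, true)) ?_ ?_ ?_ T (fun i hi => (hf _ _).2 (hT i hi)) h3
    · intro i
      have := htwo i false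
      simp only [sub_add_cancel]
      rwa [hsym (i, false) (i - 1, false)] at this
    · intro i
      have := htwo i true
      simp only [sub_add_cancel]
      rwa [hsym (i, true) (i - 1, true), hsym (i, true) (i, !true)] at this
    · intro g g' hne a1 a2 a3 a4
      have hm : (g' - g).val ≠ 0 := by
        rw [Ne, ZMod.val_eq_zero, sub_eq_zero]; exact fun h => hne h.symm
      have hstep : ∀ i b, F.Adj (i, b) (i + 1, b) →
          ((i - (g + 1)).val < (g' - g).val ↔ (i + 1 - (g + 1)).val < (g' - g).val) := by
        intro i b hA
        apply cut_step hn
        · rintro rfl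
          have := (hf _ _).2 hA
          cases b <;> simp_all
        · rintro rfl
          have := (hf _ _).2 hA
          cases b <;> simp_all
      have := closed_all F hconn (fun u => (u.1 - (g + 1)).val < (g' - g).val) ?_
        (g + 1, false) (g, false) (by simp only [sub_self, ZMod.val_zero]; omega)
      · simp only at this
        have e : g - (g + 1) = -1 := by ring
        rw [e] at this
        have h1 : (-1 : ZMod n).val = n - 1 := by
          obtain ⟨m, rfl⟩ : ∃ m, n = m + 1 := ⟨n - 1, by omega⟩
          simp [ZMod.val_neg_one]
        have := ZMod.val_lt (g' - g)
        omega
      · rintro ⟨i, b⟩ w hA hP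
        rcases (prism_adj_s11 hn i b w).1 (hle hA) with rfl | rfl | rfl
        · exact (hstep i b hA).1 hP
        · have := hstep (i - 1) b (by rw [sub_add_cancel]; exact hA.symm)
          rw [sub_add_cancel] at this
          exact this.2 hP
        · exact hP
  have hpil' : ∀ i b, f (i, b) (i, !b) = true := by
    intro i b
    cases b
    · exact hpil i
    · rw [hsym]; exact hpil i
  have hno : ∀ i b, ¬ (F.Adj (i, b) (i + 1, b) ∧ F.Adj (i + 1, b) (i + 1 + 1, b)) := by
    rintro i b ⟨h1, h2⟩
    have a := htwo (i + 1) b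
    rw [hpil', (hf _ _).2 h2, add_sub_cancel_right, (hf _ _).2 h1.symm] at a
    exact absurd a (by decide)
  have hno2 : ∀ b i j, i ≠ j → F.Adj (i, b) (i + 1, b) → F.Adj (j, b) (j + 1, b) →
      ¬ ∃ x : PV n, x ∈ s(((i, b) : PV n), (i + 1, b)) ∧ x ∈ s(((j, b) : PV n), (j + 1, b)) := by
    rintro b i j hij hi hj ⟨x, hx, hx'⟩
    simp only [Sym2.mem_iff] at hx hx'
    rcases hx with rfl | rfl <;> rcases hx' with h | h <;> have h := (Prod.mk.inj h).1
    · exact hij h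
    · subst h; exact hno j b ⟨hj, hi⟩
    · subst h; exact hno i b ⟨hi, hj⟩
    · exact hij (add_right_cancel h)
  refine ⟨v, H0.mapLe hle, ?_, ?_, ?_⟩
  · have hc : (H0.mapLe hle).IsCycle := (Walk.isCycle_mapLe hle).2 hH0
    refine ⟨hc, ?_⟩
    refine (hc.isPath_tail).isHamiltonian_of_mem ?_
    intro w
    have hw : w ∈ (H0.mapLe hle).support := by
      rw [Walk.support_mapLe_eq_support]
      exact (Walk.mem_verts_toSubgraph _).1 (hall w)
    rw [Walk.support_tail_of_not_nil _ hc.not_nil]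
    rw [Walk.mem_support_iff] at hw
    rcases hw with rfl | hw
    · exact Walk.end_mem_tail_support hc.not_nil
    · exact hw
  · intro e he e' he' hne hty
    rw [Walk.edges_mapLe_eq_edges] at he he'
    rcases hty with ⟨⟨i, rfl⟩, ⟨j, rfl⟩⟩ | ⟨⟨i, rfl⟩, ⟨j, rfl⟩⟩
    · exact hno2 false i j (fun h => hne (h ▸ rfl)) ((hedge _ _).1 he) ((hedge _ _).1 he')
    · exact hno2 true i j (fun h => hne (h ▸ rfl)) ((hedge _ _).1 he) ((hedge _ _).1 he')
  · intro u w
    rw [Walk.edges_mapLe_eq_edges]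
    exact hedge u w

end prism

lemma TF_adj (k l : Fin 15) :
    TF.Adj k l ↔ k ≠ l ∧ ((k, l) ∈ TFedges ∨ (l, k) ∈ TFedges) := by
  simp only [TF, fromRel_adj]

/-- The graph of lifted edges. -/
def FG {n : ℕ} (S : Finset (PV n)) (orient : PV n → Bool) (D : SimpleGraph (InflV n S)) :
    SimpleGraph (PV n) where
  Adj u w := (prismG n).Adj u w ∧ D.Adj (liftV S orient u w) (liftV S orient w u)
  symm := ⟨fun _ _ h => ⟨h.1.symm, h.2.symm⟩⟩
  loopless := ⟨fun _ h => h.1.ne rfl⟩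

lemma infl_local {n : ℕ} (hn : 3 ≤ n) (S : Finset (PV n)) (orient : PV n → Bool)
    (D : SimpleGraph (InflV n S)) (hle : D ≤ inflPrism n S orient) (hconn : D.Preconnected)
    (h2 : ∀ x, (D.neighborSet x).ncard = 2) (d : InflV n S → InflV n S → Bool)
    (hd : ∀ x y, d x y = true ↔ D.Adj x y) (i : ZMod n) (b : Bool) (hu : (i, b) ∈ S) :
    two (d (liftV S orient (i, b) (i + 1, b)) (liftV S orient (i + 1, b) (i, b)))
      (d (liftV S orient (i, b) (i - 1, b)) (liftV S orient (i - 1, b) (i, b)))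
      (d (liftV S orient (i, b) (i, !b)) (liftV S orient (i, !b) (i, b))) = true ∧
    d (liftV S orient (i, b) (i, !b)) (liftV S orient (i, !b) (i, b)) = true := by
  obtain ⟨w0, w1, hw, p0, p1, p2⟩ := ports hn S orient i b hu
  set u : PV n := (i, b) with hudef
  set w2 : PV n := (i, !b) with hw2
  let mk : Fin 15 → InflV n S := fun k => ⟨(u, k), Or.inl hu⟩
  have mkinj : ∀ k l, k ≠ l → mk k ≠ mk l := by
    intro k l h h'
    exact h (Prod.mk.inj (Subtype.mk.inj h')).2
  have l0 : liftV S orient u w0 = mk 0 := Subtype.ext (Prod.ext rfl p0)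
  have l1 : liftV S orient u w1 = mk 1 := Subtype.ext (Prod.ext rfl p1)
  have l2 : liftV S orient u w2 = mk 2 := Subtype.ext (Prod.ext rfl p2)
  have hprism : ∀ w, (prismG n).Adj u w → w = w0 ∨ w = w1 ∨ w = w2 := by
    intro w h
    have := (prism_adj_s11 hn i b w).1 h
    rcases hw with ⟨rfl, rfl⟩ | ⟨rfl, rfl⟩ <;> tauto
  have a0 : (prismG n).Adj u w0 := by
    rw [hudef, prism_adj_s11 hn]; rcases hw with ⟨rfl, rfl⟩ | ⟨rfl, rfl⟩ <;> simp
  have a1 : (prismG n).Adj u w1 := by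
    rw [hudef, prism_adj_s11 hn]; rcases hw with ⟨rfl, rfl⟩ | ⟨rfl, rfl⟩ <;> simp
  have a2 : (prismG n).Adj u w2 := by
    rw [hudef, prism_adj_s11 hn]; simp [hw2]
  have hnb : ∀ k y, D.Adj (mk k) y → (∃ l, y = mk l ∧ TF.Adj k l) ∨
      (k = 0 ∧ y = liftV S orient w0 u) ∨ (k = 1 ∧ y = liftV S orient w1 u) ∨
      (k = 2 ∧ y = liftV S orient w2 u) := by
    intro k y h
    rcases infl_adj S orient _ _ (hle h) with ⟨e1, -, e3⟩ | ⟨e1, e2, e3⟩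
    · exact Or.inl ⟨y.val.2, Subtype.ext (Prod.ext e1.symm rfl), e3⟩
    · right
      have hk : k = port S orient u y.val.1 := congrArg (fun z => z.val.2) e2
      have hp : (prismG n).Adj u y.val.1 := e1
      change y = liftV S orient y.val.1 u at e3
      generalize y.val.1 = w at hk hp e3
      rcases hprism w hp with rfl | rfl | rfl
      · left; exact ⟨by rw [hk, p0], e3⟩
      · right; left; exact ⟨by rw [hk, p1], e3⟩
      · right; right; exact ⟨by rw [hk, p2], e3⟩
  have hs : ∀ x y, d x y = d y x := by
    intro x y
    rw [Bool.eq_iff_iff, hd, hd, D.adj_comm]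
  have hE : ∀ k l, d (mk k) (mk l) = d (mk l) (mk k) := fun k l => hs _ _
  have deg3 : ∀ k a b c : Fin 15, k ≠ 0 ∧ k ≠ 1 ∧ k ≠ 2 ∧ a ≠ b ∧ a ≠ c ∧ b ≠ c ∧
      (∀ l, (k, l) ∈ TFedges ∨ (l, k) ∈ TFedges → l = a ∨ l = b ∨ l = c) →
      two (d (mk k) (mk a)) (d (mk k) (mk b)) (d (mk k) (mk c)) = true := by
    rintro k a b c ⟨k0, k1, k2, hab, hac, hbc, h⟩
    refine two_of_ncard D d hd _ _ _ _ (mkinj _ _ hab) (mkinj _ _ hac) (mkinj _ _ hbc) (h2 _) ?_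
    intro y hy
    rcases hnb k y hy with ⟨l, rfl, hl⟩ | ⟨h', -⟩ | ⟨h', -⟩ | ⟨h', -⟩
    · rcases h l ((TF_adj k l).1 hl).2 with rfl | rfl | rfl <;> simp
    all_goals contradiction
  have hlne : ∀ k w, (prismG n).Adj u w → mk k ≠ liftV S orient w u := by
    intro k w h h'
    exact h.ne (congrArg (fun z => z.val.1) h')
  have degp : ∀ (k a b : Fin 15) (w : PV n), (prismG n).Adj u w →
      (∀ y, (k = 0 ∧ y = liftV S orient w0 u) ∨ (k = 1 ∧ y = liftV S orient w1 u) ∨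
      (k = 2 ∧ y = liftV S orient w2 u) → y = liftV S orient w u) → (a ≠ b ∧
      (∀ l, (k, l) ∈ TFedges ∨ (l, k) ∈ TFedges → l = a ∨ l = b)) →
      two (d (mk k) (mk a)) (d (mk k) (mk b)) (d (mk k) (liftV S orient w u)) = true := by
    rintro k a b w hw hy ⟨hab, h⟩
    refine two_of_ncard D d hd _ _ _ _ (mkinj _ _ hab) (hlne _ _ hw) (hlne _ _ hw) (h2 _) ?_
    intro y hA
    rcases hnb k y hA with ⟨l, rfl, hl⟩ | h'
    · rcases h l ((TF_adj k l).1 hl).2 with rfl | rfl <;> simp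
    · right; right; exact hy y h'
  have key := frag (fun k l => d (mk k) (mk l)) (d (mk 0) (liftV S orient w0 u))
    (d (mk 1) (liftV S orient w1 u)) (d (mk 2) (liftV S orient w2 u))
    (by have := degp 0 4 14 w0 a0 (by simp) (by decide); grind)
    (by have := degp 1 7 14 w1 a1 (by simp) (by decide); grind)
    (by have := degp 2 6 8 w2 a2 (by simp) (by decide); grind)
    (by have := deg3 3 9 10 14 (by decide); grind)
    (by have := deg3 4 0 5 9 (by decide); grind)
    (by have := deg3 5 4 6 11 (by decide); grind)
    (by have := deg3 6 5 2 13 (by decide); grind)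
    (by have := deg3 7 1 8 10 (by decide); grind)
    (by have := deg3 8 7 2 13 (by decide); grind)
    (by have := deg3 9 4 3 11 (by decide); grind)
    (by have := deg3 10 3 7 12 (by decide); grind)
    (by have := deg3 11 5 12 9 (by decide); grind)
    (by have := deg3 12 11 13 10 (by decide); grind)
    (by have := deg3 13 6 8 12 (by decide); grind)
    (by have := deg3 14 0 1 3 (by decide); grind)
  rcases key with ⟨k1, k2⟩ | ⟨K, hK, q0, q1, q2, hcl⟩
  · rw [← l0, ← l1, ← l2] at k1
    rw [← l2] at k2
    refine ⟨?_, k2⟩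
    rcases hw with ⟨rfl, rfl⟩ | ⟨rfl, rfl⟩
    · exact k1
    · unfold two at k1 ⊢
      grind
  · exfalso
    obtain ⟨k, hk⟩ := List.exists_mem_of_ne_nil K hK
    have := closed_all D hconn (fun z => ∃ l ∈ K, z = mk l) ?_ (mk k) (liftV S orient w2 u)
      ⟨k, hk, rfl⟩
    · obtain ⟨l, -, h⟩ := this
      exact hlne l w2 a2 h.symm
    · rintro x y hA ⟨l, hl, rfl⟩
      have hdA := (hd _ _).2 hA
      rcases hnb l y hA with ⟨m, rfl, hm⟩ | ⟨rfl, rfl⟩ | ⟨rfl, rfl⟩ | ⟨rfl, rfl⟩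
      · refine ⟨m, ?_, rfl⟩
        rcases ((TF_adj l m).1 hm).2 with h | h
        · rcases hcl _ h with h | h
          · exact h.1 hl
          · exact absurd hdA (by simpa using h)
        · rcases hcl _ h with h | h
          · exact h.2 hl
          · rw [hE] at hdA
            exact absurd hdA (by simpa using h)
      · rw [q0 hl] at hdA; cases hdA
      · rw [q1 hl] at hdA; cases hdA
      · rw [q2 hl] at hdA; cases hdA

lemma noninfl_local {n : ℕ} (hn : 3 ≤ n) (S : Finset (PV n)) (orient : PV n → Bool)
    (D : SimpleGraph (InflV n S)) (hle : D ≤ inflPrism n S orient)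
    (h2 : ∀ x, (D.neighborSet x).ncard = 2) (d : InflV n S → InflV n S → Bool)
    (hd : ∀ x y, d x y = true ↔ D.Adj x y) (i : ZMod n) (b : Bool) (hu : (i, b) ∉ S) :
    two (d (liftV S orient (i, b) (i + 1, b)) (liftV S orient (i + 1, b) (i, b)))
      (d (liftV S orient (i, b) (i - 1, b)) (liftV S orient (i - 1, b) (i, b)))
      (d (liftV S orient (i, b) (i, !b)) (liftV S orient (i, !b) (i, b))) = true := by
  have hl : ∀ w, liftV S orient (i, b) w = ⟨((i, b), 0), Or.inr rfl⟩ := by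
    intro w
    exact Subtype.ext (Prod.ext rfl (by simp [liftV, port, hu]))
  have hne : ∀ w w' u : PV n, w ≠ w' → liftV S orient w u ≠ liftV S orient w' u := by
    intro w w' u h h'
    exact h (congrArg (fun z => z.val.1) h')
  obtain ⟨n1, n2, n3⟩ := prism_ne hn i b
  rw [hl, hl, hl]
  refine two_of_ncard D d hd _ _ _ _ (hne _ _ _ n1) (hne _ _ _ n2) (hne _ _ _ n3) (h2 _) ?_
  intro y hy
  rcases infl_adj S orient _ _ (hle hy) with ⟨-, e2, -⟩ | ⟨e1, -, e3⟩
  · exact absurd e2 hu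
  · change (prismG n).Adj (i, b) y.val.1 at e1
    change y = liftV S orient y.val.1 (i, b) at e3
    generalize y.val.1 = w at e1 e3
    subst e3
    rcases (prism_adj_s11 hn i b w).1 e1 with rfl | rfl | rfl <;> simp


/-- Let `G` be obtained from `C_n □ K_2`, `n` even, by TF-inflations at
vertices of at least `3` distinct pillars.  Then every hamiltonian cycle of `G`, after
contracting all edges lying inside the inserted Tutte Fragments, yields one of the (two)
meandering hamiltonian cycles of `C_n □ K_2`: there is a meandering hamiltonian cycle `H`
of the prism using exactly the prism edges whose lifts occur in the given cycle. -/
theorem stmt11 (n : ℕ) (hn : 3 ≤ n) (heven : Even n) (S : Finset (PV n))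
    (orient : PV n → Bool) (hpil : 3 ≤ (inflatedPillars S).ncard)
    {x : InflV n S} (C : (inflPrism n S orient).Walk x x) (hC : C.IsHamiltonianCycle) :
    ∃ (v : PV n) (H : (prismG n).Walk v v), H.IsHamiltonianCycle ∧ Meandering H ∧
      ∀ u w : PV n, (prismG n).Adj u w →
        (s(u, w) ∈ H.edges ↔ s(liftV S orient u w, liftV S orient w u) ∈ C.edges) := by
  classical
  let D : SimpleGraph (InflV n S) := C.toSubgraph.spanningCoe
  have hDadj : ∀ y z, D.Adj y z ↔ s(y, z) ∈ C.edges := fun y z =>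
    Walk.adj_toSubgraph_iff_mem_edges
  have hle : D ≤ inflPrism n S orient := C.toSubgraph.spanningCoe_le
  have h2 : ∀ y, (D.neighborSet y).ncard = 2 := fun y =>
    hC.isCycle.ncard_neighborSet_toSubgraph_eq_two (hC.mem_support y)
  have hconn : D.Preconnected := by
    have hx : ∀ y, D.Reachable x y := by
      intro y
      have hy := hC.mem_support y
      let p := C.takeUntil y hy
      have hp : ∀ e ∈ p.edges, e ∈ D.edgeSet := by
        intro e he
        have he := C.edges_takeUntil_subset_edges hy he
        induction e with
        | _ a b => exact (hDadj a b).2 he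
      exact ⟨p.transfer D hp⟩
    exact fun y z => (hx y).symm.trans (hx z)
  let d : InflV n S → InflV n S → Bool := fun y z => decide (D.Adj y z)
  have hd : ∀ y z, d y z = true ↔ D.Adj y z := fun y z => by simp [d]
  let F := FG S orient D
  have hFle : F ≤ prismG n := fun _ _ h => h.1
  have hFconn : F.Preconnected := by
    have hw : ∀ y z : InflV n S, F.Reachable y.val.1 z.val.1 := by
      intro y z
      refine closed_all D hconn (fun z => F.Reachable y.val.1 z.val.1) ?_ y z (Reachable.refl _)
      intro a b hab ha
      rcases infl_adj S orient _ _ (hle hab) with ⟨e1, -, -⟩ | ⟨e1, e2, e3⟩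
      · rwa [← e1]
      · refine ha.trans (Adj.reachable ⟨e1, ?_⟩)
        rw [← e2, ← e3]; exact hab
    intro u w
    exact hw ⟨(u, 0), Or.inr rfl⟩ ⟨(w, 0), Or.inr rfl⟩
  let f : PV n → PV n → Bool := fun u w => decide (F.Adj u w)
  have hf : ∀ u w, f u w = true ↔ F.Adj u w := fun u w => by simp [f]
  have hfd : ∀ u w, (prismG n).Adj u w → d (liftV S orient u w) (liftV S orient w u) = f u w := by
    intro u w h
    rw [Bool.eq_iff_iff, hd, hf]
    exact ⟨fun h' => ⟨h, h'⟩, fun h' => h'.2⟩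
  have b1 : ∀ i b, (prismG n).Adj (i, b) (i + 1, b) := fun i b => (prism_adj_s11 hn _ _ _).2 (by simp)
  have b2 : ∀ i b, (prismG n).Adj (i, b) (i - 1, b) := fun i b => (prism_adj_s11 hn _ _ _).2 (by simp)
  have b3 : ∀ i b, (prismG n).Adj (i, b) (i, !b) := fun i b => (prism_adj_s11 hn _ _ _).2 (by simp)
  have A1 : ∀ i b, two (f (i, b) (i + 1, b)) (f (i, b) (i - 1, b)) (f (i, b) (i, !b)) = true := by
    intro i b
    rw [← hfd _ _ (b1 i b), ← hfd _ _ (b2 i b), ← hfd _ _ (b3 i b)]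
    by_cases hu : (i, b) ∈ S
    · exact (infl_local hn S orient D hle hconn h2 d hd i b hu).1
    · exact noninfl_local hn S orient D hle h2 d hd i b hu
  have A2 : ∀ i ∈ inflatedPillars S, F.Adj (i, false) (i, true) := by
    rintro i (hu | hu)
    · have := (infl_local hn S orient D hle hconn h2 d hd i _ hu).2
      rw [hfd _ _ (b3 i _), hf] at this
      exact this
    · have := (infl_local hn S orient D hle hconn h2 d hd i _ hu).2
      rw [hfd _ _ (b3 i _), hf] at this
      exact this.symm
  obtain ⟨v, H, hH, hM, hE⟩ := prism_main hn F hFle hFconn f hf A1 (inflatedPillars S) A2 hpil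
  refine ⟨v, H, hH, hM, fun u w huw => ?_⟩
  rw [hE, ← hDadj]
  exact ⟨fun h' => h'.2, fun h' => ⟨huw, h'⟩⟩
end
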